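/- arXiv:2410.08056 — 2 statements merged into one kernel-verified Lean document; each statement's English description precedes it below -/
import Mathlib

section
/- For every 1 < p < ∞ and every t ∈ (0,1), the inequality [ (1/(t(p−1)))·( (1−t)^{−(p−1)} − 1 ) ]^{1/p} < 1/(1−t) holds. Consequently, for each 1 ≤ p < ∞ and t ∈ (0,1), the upper norm estimates ‖C_t‖_{H^1→H^1} ≤ (−log(1−t))/t and ‖C_t‖_{H^p→H^p} ≤ [ (1/(t(p−1)))·( (1−t)^{−(p−1)} − 1 ) ]^{1/p} (for p > 1) are strictly smaller than 1/(1−t). -/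
/-- For `1 < p < ∞` and `t ∈ (0,1)`:
`[ (1/(t(p-1)))((1-t)^{-(p-1)} - 1) ]^{1/p} < 1/(1-t)`, and also
`(-log(1-t))/t < 1/(1-t)`; that is, the upper estimates for `‖C_t‖_{H^p → H^p}`
(`p > 1`) and `‖C_t‖_{H^1 → H^1}` are strictly smaller than `1/(1-t)`. -/
theorem cesaro_norm_estimates_better (p t : ℝ) (hp : 1 < p) (ht0 : 0 < t) (ht1 : t < 1) :
    ((1 / (t * (p - 1))) * ((1 - t) ^ (-(p - 1)) - 1)) ^ (1 / p) < 1 / (1 - t) ∧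
    -Real.log (1 - t) / t < 1 / (1 - t) := by
  have hs : 0 < 1 - t := by linarith
  have hq : 0 < p - 1 := by linarith
  have hp0 : 0 < p := by linarith
  have hlog : -Real.log (1 - t) < t / (1 - t) := by
    have h := Real.log_lt_sub_one_of_pos (inv_pos.mpr hs) (by
      intro h
      rw [inv_eq_one] at h
      linarith)
    rw [Real.log_inv] at h
    have e : (1 - t)⁻¹ - 1 = t / (1 - t) := by
      field_simp
      ring
    rwa [e] at h
  refine ⟨?_, ?_⟩
  · have hpow : 1 - (p - 1) * (t / (1 - t)) < (1 - t) ^ (p - 1) := by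
      rw [Real.rpow_def_of_pos hs]
      have h := Real.add_one_le_exp (Real.log (1 - t) * (p - 1))
      nlinarith [mul_lt_mul_of_pos_right hlog hq]
    have hx : 0 < (1 - t) ^ (p - 1) := Real.rpow_pos_of_pos hs _
    have hx1 : (1 - t) ^ (p - 1) ≤ 1 := Real.rpow_le_one hs.le (by linarith) hq.le
    have hsp : (1 / (1 - t)) ^ p = ((1 - t) ^ (p - 1))⁻¹ / (1 - t) := by
      rw [one_div, Real.inv_rpow hs.le, Real.rpow_sub_one hs.ne']
      field_simp
    rw [Real.rpow_neg hs.le, one_div p, Real.rpow_inv_lt_iff_of_pos _ (by positivity) hp0, hsp]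
    · set x := (1 - t) ^ (p - 1)
      have h : x⁻¹ - 1 < (t * (p - 1)) * (x⁻¹ / (1 - t)) := by
        calc x⁻¹ - 1 = (1 - x) * x⁻¹ := by field_simp
          _ < ((p - 1) * (t / (1 - t))) * x⁻¹ :=
            mul_lt_mul_of_pos_right (by linarith) (inv_pos.mpr hx)
          _ = _ := by ring
      rw [one_div, inv_mul_lt_iff₀ (by positivity)]
      exact h
    · have : 1 ≤ ((1 - t) ^ (p - 1))⁻¹ := (one_le_inv₀ hx).mpr hx1
      exact mul_nonneg (by positivity) (by linarith)
  · rw [div_lt_iff₀ ht0]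
    calc -Real.log (1 - t) < t / (1 - t) := hlog
      _ = _ := by ring
end

section
/- Let 1 ≤ p < ∞ and t ∈ (0,1). The generalized Cesàro operator C_t : H^p → H^p is compact, and consequently the operator S_t := S ∘ C_t, given by (S_t f)(z) = ∫_0^z f(ξ)/(1−tξ) dξ, is also compact on H^p. -/
open Complex MeasureTheory Metric Set Filter Topology

/-- The generalized Cesàro operator `C_t`, given by
`(C_t f)(z) = ∫_0^1 f(sz)/(1 - s t z) ds`, which equals `f(0)` at `z = 0` and
`(1/z)∫_0^z f(ξ)/(1 - tξ) dξ` for `z ≠ 0`. -/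
noncomputable def cesaro (t : ℝ) (f : ℂ → ℂ) (z : ℂ) : ℂ :=
  ∫ s in (0:ℝ)..1, f ((s : ℂ) * z) / (1 - (s : ℂ) * (t : ℂ) * z)

/-- The integral means `M_p(r, f)`. -/
noncomputable def Mp (p : ℝ) (r : ℝ) (f : ℂ → ℂ) : ℝ :=
  ((1 / (2 * Real.pi)) *
    ∫ θ in (0:ℝ)..(2 * Real.pi), ‖f ((r : ℂ) * Complex.exp ((θ : ℂ) * Complex.I))‖ ^ p) ^ (1 / p)

/-- The Hardy space norm `‖f‖_p = sup_{0 ≤ r < 1} M_p(r, f)`. -/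
noncomputable def hardyNorm (p : ℝ) (f : ℂ → ℂ) : ℝ :=
  sSup ((fun r => Mp p r f) '' Set.Ico (0:ℝ) 1)

/-- Membership in the Hardy space `H^p`: holomorphic on the unit disc with bounded
integral means. -/
def MemHp (p : ℝ) (f : ℂ → ℂ) : Prop :=
  DifferentiableOn ℂ f (Metric.ball (0:ℂ) 1) ∧
    BddAbove ((fun r => Mp p r f) '' Set.Ico (0:ℝ) 1)

/-- The unnormalised integral `∫ ‖f(r e^{iθ})‖ ^ p dθ` over the circle of radius `r`. -/
noncomputable def circlePow (p : ℝ) (r : ℝ) (f : ℂ → ℂ) : ℝ :=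
  ∫ θ in (0:ℝ)..(2 * Real.pi), ‖f ((r : ℂ) * Complex.exp ((θ : ℂ) * Complex.I))‖ ^ p

lemma circlePow_nonneg (p r : ℝ) (f : ℂ → ℂ) : 0 ≤ circlePow p r f :=
  intervalIntegral.integral_nonneg (by positivity) fun _ _ => by positivity

lemma Mp_le_iff {p r C : ℝ} {f : ℂ → ℂ} (hp : 0 < p) (hC : 0 ≤ C) :
    Mp p r f ≤ C ↔ circlePow p r f ≤ 2 * Real.pi * C ^ p := by
  have h0 := circlePow_nonneg p r f
  have hpi := Real.pi_pos
  change ((1 / (2 * Real.pi)) * circlePow p r f) ^ (1 / p) ≤ C ↔ _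
  rw [one_div p, Real.rpow_inv_le_iff_of_pos (by positivity) hC hp, one_div,
    inv_mul_le_iff₀ (by positivity)]

lemma Mp_nonneg (p r : ℝ) (f : ℂ → ℂ) : 0 ≤ Mp p r f := by
  have h0 := circlePow_nonneg p r f
  change 0 ≤ ((1 / (2 * Real.pi)) * circlePow p r f) ^ (1 / p)
  have hpi := Real.pi_pos
  positivity

lemma hardyNorm_nonneg (p : ℝ) (f : ℂ → ℂ) : 0 ≤ hardyNorm p f := by
  refine Real.sSup_nonneg ?_
  rintro _ ⟨r, -, rfl⟩
  exact Mp_nonneg p r f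

lemma hardyNorm_le {p C : ℝ} {f : ℂ → ℂ} (hp : 0 < p) (hC : 0 ≤ C)
    (h : ∀ r ∈ Ico (0:ℝ) 1, circlePow p r f ≤ 2 * Real.pi * C ^ p) : hardyNorm p f ≤ C := by
  refine Real.sSup_le ?_ hC
  rintro _ ⟨r, hr, rfl⟩
  exact (Mp_le_iff hp hC).2 (h r hr)

lemma memHp_iff {p : ℝ} {f : ℂ → ℂ} (hp : 0 < p) :
    MemHp p f ↔ DifferentiableOn ℂ f (ball (0:ℂ) 1) ∧
      ∃ C, ∀ r ∈ Ico (0:ℝ) 1, circlePow p r f ≤ C := by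
  have hpi := Real.pi_pos
  refine and_congr_right fun _ => ⟨?_, ?_⟩
  · rintro ⟨C, hC⟩
    refine ⟨2 * Real.pi * C ^ p, fun r hr => ?_⟩
    have h : Mp p r f ≤ C := hC ⟨r, hr, rfl⟩
    exact (Mp_le_iff hp ((Mp_nonneg p r f).trans h)).1 h
  · rintro ⟨C, hC⟩
    have hC0 : 0 ≤ C := (circlePow_nonneg p 0 f).trans (hC 0 (by simp))
    refine ⟨((2 * Real.pi)⁻¹ * C) ^ p⁻¹, ?_⟩
    rintro _ ⟨r, hr, rfl⟩
    refine (Mp_le_iff hp (by positivity)).2 ((hC r hr).trans_eq ?_)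
    rw [Real.rpow_inv_rpow (by positivity) hp.ne']
    field_simp

lemma circlePow_le_of_hardyNorm_le_one {p r : ℝ} {f : ℂ → ℂ} (hp : 0 < p) (hf : MemHp p f)
    (h : hardyNorm p f ≤ 1) (hr : r ∈ Ico (0:ℝ) 1) : circlePow p r f ≤ 2 * Real.pi := by
  have h1 : Mp p r f ≤ 1 := (le_csSup hf.2 ⟨r, hr, rfl⟩).trans h
  simpa using (Mp_le_iff hp zero_le_one).1 h1

lemma norm_ofReal_mul_exp (r θ : ℝ) (hr : 0 ≤ r) :
    ‖(r : ℂ) * Complex.exp ((θ : ℂ) * Complex.I)‖ = r := by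
  rw [norm_mul, Complex.norm_exp_ofReal_mul_I, mul_one, Complex.norm_real, Real.norm_of_nonneg hr]

lemma continuous_comp_circle {r : ℝ} {f : ℂ → ℂ} (hf : ContinuousOn f (ball (0:ℂ) 1))
    (hr : r ∈ Ico (0:ℝ) 1) :
    Continuous fun θ : ℝ => f ((r : ℂ) * Complex.exp ((θ : ℂ) * Complex.I)) := by
  refine hf.comp_continuous (by fun_prop) fun θ => ?_
  rw [mem_ball_zero_iff, norm_ofReal_mul_exp r θ hr.1]
  exact hr.2

lemma continuous_circlePow_integrand {p r : ℝ} {f : ℂ → ℂ} (hp : 0 ≤ p)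
    (hf : ContinuousOn f (ball (0:ℂ) 1)) (hr : r ∈ Ico (0:ℝ) 1) :
    Continuous fun θ : ℝ => ‖f ((r : ℂ) * Complex.exp ((θ : ℂ) * Complex.I))‖ ^ p :=
  (continuous_comp_circle hf hr).norm.rpow_const fun _ => Or.inr hp

lemma rpow_le_two_rpow_mul_add {p a x y : ℝ} (hp : 0 ≤ p) (ha : 0 ≤ a) (hx : 0 ≤ x) (hy : 0 ≤ y)
    (h : a ≤ x + y) : a ^ p ≤ 2 ^ p * (x ^ p + y ^ p) := by
  have hx' : 0 ≤ x ^ p := by positivity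
  have hy' : 0 ≤ y ^ p := by positivity
  have h2 : (0:ℝ) ≤ 2 ^ p := by positivity
  rcases le_total x y with hxy | hxy
  · calc a ^ p ≤ (2 * y) ^ p := Real.rpow_le_rpow ha (by linarith) hp
      _ = 2 ^ p * y ^ p := Real.mul_rpow (by norm_num) hy
      _ ≤ _ := by gcongr; linarith
  · calc a ^ p ≤ (2 * x) ^ p := Real.rpow_le_rpow ha (by linarith) hp
      _ = 2 ^ p * x ^ p := Real.mul_rpow (by norm_num) hx
      _ ≤ _ := by gcongr; linarith

lemma circlePow_le_of_norm_le_add {p r : ℝ} {h f g : ℂ → ℂ} (hp : 0 ≤ p)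
    (hh : ContinuousOn h (ball (0:ℂ) 1))
    (hf : ContinuousOn f (ball (0:ℂ) 1)) (hg : ContinuousOn g (ball (0:ℂ) 1))
    (hr : r ∈ Ico (0:ℝ) 1) (hle : ∀ z, ‖z‖ = r → ‖h z‖ ≤ ‖f z‖ + ‖g z‖) :
    circlePow p r h ≤ 2 ^ p * (circlePow p r f + circlePow p r g) := by
  have cf := continuous_circlePow_integrand hp hf hr
  have cg := continuous_circlePow_integrand hp hg hr
  rw [circlePow, circlePow, circlePow, ← intervalIntegral.integral_add
    (cf.intervalIntegrable _ _) (cg.intervalIntegrable _ _), ← intervalIntegral.integral_const_mul]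
  refine intervalIntegral.integral_mono_on (by positivity)
    ((continuous_circlePow_integrand hp hh hr).intervalIntegrable _ _)
    ((continuous_const.mul (cf.add cg)).intervalIntegrable _ _) fun θ _ => ?_
  exact rpow_le_two_rpow_mul_add hp (norm_nonneg _) (norm_nonneg _) (norm_nonneg _)
    (hle _ (norm_ofReal_mul_exp r θ hr.1))

lemma circlePow_mono {p r : ℝ} {h f : ℂ → ℂ} (hp : 0 ≤ p)
    (hh : ContinuousOn h (ball (0:ℂ) 1)) (hf : ContinuousOn f (ball (0:ℂ) 1))
    (hr : r ∈ Ico (0:ℝ) 1) (hle : ∀ z, ‖z‖ = r → ‖h z‖ ≤ ‖f z‖) :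
    circlePow p r h ≤ circlePow p r f :=
  intervalIntegral.integral_mono_on (by positivity)
    ((continuous_circlePow_integrand hp hh hr).intervalIntegrable _ _)
    ((continuous_circlePow_integrand hp hf hr).intervalIntegrable _ _) fun θ _ =>
      Real.rpow_le_rpow (norm_nonneg _) (hle _ (norm_ofReal_mul_exp r θ hr.1)) hp

lemma circlePow_const (p r : ℝ) (c : ℂ) : circlePow p r (fun _ => c) = 2 * Real.pi * ‖c‖ ^ p := by
  simp [circlePow]

lemma one_sub_le_norm_one_sub_mul {t : ℝ} {w : ℂ} (ht0 : 0 < t) (hw : ‖w‖ ≤ 1) :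
    1 - t ≤ ‖1 - (t : ℂ) * w‖ := by
  have h : ‖(t : ℂ) * w‖ ≤ t := by
    rw [norm_mul, Complex.norm_real, Real.norm_of_nonneg ht0.le]
    exact mul_le_of_le_one_right ht0.le hw
  have := norm_sub_norm_le (1 : ℂ) ((t : ℂ) * w)
  rw [norm_one] at this
  linarith

lemma ofReal_mul_mem_ball {s : ℝ} {z : ℂ} (hs : s ∈ Icc (0:ℝ) 1) (hz : z ∈ ball (0:ℂ) 1) :
    (s : ℂ) * z ∈ ball (0:ℂ) 1 := by
  rw [mem_ball_zero_iff] at *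
  rw [norm_mul, Complex.norm_real, Real.norm_of_nonneg hs.1]
  exact (mul_le_of_le_one_left (norm_nonneg _) hs.2).trans_lt hz

lemma differentiableOn_div_one_sub {t : ℝ} (ht0 : 0 < t) (ht1 : t < 1) {f : ℂ → ℂ}
    (hf : DifferentiableOn ℂ f (ball (0:ℂ) 1)) :
    DifferentiableOn ℂ (fun w => f w / (1 - (t : ℂ) * w)) (ball (0:ℂ) 1) := by
  refine hf.div (by fun_prop) fun w hw => ?_
  rw [mem_ball_zero_iff] at hw
  exact norm_pos_iff.1 ((sub_pos.2 ht1).trans_le (one_sub_le_norm_one_sub_mul ht0 hw.le))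

lemma continuousOn_cesaro_integrand {t : ℝ} (ht0 : 0 < t) (ht1 : t < 1) {f : ℂ → ℂ}
    (hf : DifferentiableOn ℂ f (ball (0:ℂ) 1)) {z : ℂ} (hz : z ∈ ball (0:ℂ) 1) :
    ContinuousOn (fun s : ℝ => f ((s : ℂ) * z) / (1 - (s : ℂ) * (t : ℂ) * z)) (uIcc 0 1) := by
  rw [uIcc_of_le zero_le_one]
  have h := (differentiableOn_div_one_sub ht0 ht1 hf).continuousOn.comp
    (f := fun s : ℝ => (s : ℂ) * z) (s := Icc (0:ℝ) 1) (by fun_prop)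
    fun s hs => ofReal_mul_mem_ball hs hz
  refine h.congr fun s _ => ?_
  simp only [Function.comp]
  ring_nf

lemma cesaro_sub {t : ℝ} (ht0 : 0 < t) (ht1 : t < 1) {f g : ℂ → ℂ}
    (hf : DifferentiableOn ℂ f (ball (0:ℂ) 1)) (hg : DifferentiableOn ℂ g (ball (0:ℂ) 1))
    {z : ℂ} (hz : z ∈ ball (0:ℂ) 1) :
    cesaro t (fun w => f w - g w) z = cesaro t f z - cesaro t g z := by
  rw [cesaro, cesaro, cesaro, ← intervalIntegral.integral_sub
    (continuousOn_cesaro_integrand ht0 ht1 hf hz).intervalIntegrable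
    (continuousOn_cesaro_integrand ht0 ht1 hg hz).intervalIntegrable]
  simp only [sub_div]

lemma differentiableOn_cesaro {t : ℝ} (ht0 : 0 < t) (ht1 : t < 1) {f : ℂ → ℂ}
    (hf : DifferentiableOn ℂ f (ball (0:ℂ) 1)) :
    DifferentiableOn ℂ (cesaro t f) (ball (0:ℂ) 1) := by
  obtain ⟨G, hG⟩ := (differentiableOn_div_one_sub ht0 ht1 hf).isExactOn_ball
  have hGd : DifferentiableOn ℂ G (ball (0:ℂ) 1) := fun z hz =>
    (hG z hz).differentiableAt.differentiableWithinAt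
  have h0 : (0:ℂ) ∈ ball (0:ℂ) 1 := by simp
  refine ((Complex.differentiableOn_dslope (isOpen_ball.mem_nhds h0)).2 hGd).congr
    fun z hz => ?_
  rcases eq_or_ne z 0 with rfl | hz0
  · rw [dslope_same, (hG 0 h0).deriv]
    simp [cesaro]
  · have key : ∫ s in (0:ℝ)..1, z * (f ((s : ℂ) * z) / (1 - (s : ℂ) * (t : ℂ) * z))
        = G (((1:ℝ) : ℂ) * z) - G (((0:ℝ) : ℂ) * z) := by
      refine intervalIntegral.integral_eq_sub_of_hasDerivAt (f := fun s : ℝ => G ((s : ℂ) * z))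
        (fun s hs => ?_) ?_
      · rw [uIcc_of_le zero_le_one] at hs
        have h1 : HasDerivAt (fun s : ℂ => s * z) z (s : ℂ) := by
          simpa using (hasDerivAt_id (s : ℂ)).mul_const z
        have h2 := ((hG _ (ofReal_mul_mem_ball hs hz)).comp (s : ℂ) h1).comp_ofReal
        refine h2.congr_deriv ?_
        ring_nf
      · exact ((continuousOn_cesaro_integrand ht0 ht1 hf hz).const_mul z).intervalIntegrable
    rw [intervalIntegral.integral_const_mul] at key
    rw [dslope_of_ne _ hz0, slope_def_field, sub_zero, eq_div_iff hz0, mul_comm, cesaro, key]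
    simp

lemma norm_cesaro_le {t : ℝ} (ht0 : 0 < t) (ht1 : t < 1) {f : ℂ → ℂ}
    (hf : DifferentiableOn ℂ f (ball (0:ℂ) 1)) {z : ℂ} (hz : z ∈ ball (0:ℂ) 1) :
    ‖cesaro t f z‖ ≤ (1 - t)⁻¹ * ∫ s in (0:ℝ)..1, ‖f ((s : ℂ) * z)‖ := by
  have hc : ContinuousOn (fun s : ℝ => ‖f ((s : ℂ) * z)‖) (Icc (0:ℝ) 1) :=
    (hf.continuousOn.comp (f := fun s : ℝ => (s : ℂ) * z) (by fun_prop)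
      fun s hs => ofReal_mul_mem_ball hs hz).norm
  rw [← intervalIntegral.integral_const_mul, cesaro]
  refine intervalIntegral.norm_integral_le_of_norm_le zero_le_one ?_
    (ContinuousOn.intervalIntegrable (by rw [uIcc_of_le zero_le_one]; exact hc.const_mul _))
  refine Eventually.of_forall fun s hs => ?_
  have h1 := one_sub_le_norm_one_sub_mul ht0
    (mem_ball_zero_iff.1 (ofReal_mul_mem_ball ⟨hs.1.le, hs.2⟩ hz)).le
  have h2 : (1:ℂ) - (s : ℂ) * (t : ℂ) * z = 1 - (t : ℂ) * ((s : ℂ) * z) := by ring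
  have h3 : 0 < 1 - t := sub_pos.2 ht1
  rw [norm_div, h2, div_eq_inv_mul]
  gcongr

lemma rpow_integral_le_integral_rpow {p : ℝ} (hp : 1 ≤ p) {u : ℝ → ℝ} (hu : Continuous u)
    (hu0 : ∀ s, 0 ≤ u s) :
    (∫ s in (0:ℝ)..1, u s) ^ p ≤ ∫ s in (0:ℝ)..1, u s ^ p := by
  have hp0 : 0 ≤ p := zero_le_one.trans hp
  have : IsProbabilityMeasure (volume.restrict (Ioc (0:ℝ) 1)) := ⟨by simp⟩
  have hup : Continuous fun s => u s ^ p := hu.rpow_const fun _ => Or.inr hp0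
  rw [intervalIntegral.integral_of_le zero_le_one, intervalIntegral.integral_of_le zero_le_one]
  exact (convexOn_rpow hp).map_integral_le
    (continuousOn_id.rpow_const fun _ _ => Or.inr hp0) isClosed_Ici
    (Eventually.of_forall hu0) (hu.intervalIntegrable 0 1).1 (hup.intervalIntegrable 0 1).1

/-- Jensen's inequality and Fubini's theorem bound the integral means of `cesaro t f` by those of
`f`, split at the radius `ρ`. -/
lemma circlePow_cesaro_le {p t : ℝ} (hp : 1 ≤ p) (ht0 : 0 < t) (ht1 : t < 1) {f : ℂ → ℂ}
    (hf : DifferentiableOn ℂ f (ball (0:ℂ) 1)) {K A ρ r : ℝ} (hr : r ∈ Ico (0:ℝ) 1)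
    (hρ : ρ ∈ Icc (0:ℝ) 1) (hA : ∀ s ∈ Icc (0:ℝ) ρ, circlePow p (s * r) f ≤ A)
    (hK : ∀ s ∈ Icc (0:ℝ) 1, circlePow p (s * r) f ≤ K) :
    circlePow p r (cesaro t f) ≤ ((1 - t)⁻¹) ^ p * (ρ * A + (1 - ρ) * K) := by
  have hp0 : 0 ≤ p := zero_le_one.trans hp
  have h3 : 0 < 1 - t := sub_pos.2 ht1
  let c : ℝ → ℝ := fun s => max 0 (min s 1)
  have hc : ∀ s, c s ∈ Icc (0:ℝ) 1 := fun s =>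
    ⟨le_max_left _ _, max_le zero_le_one (min_le_right _ _)⟩
  have hcs : ∀ s ∈ Icc (0:ℝ) 1, c s = s := fun s hs => by simp [c, hs.1, hs.2]
  have hcc : Continuous c := by fun_prop
  let e : ℝ → ℂ := fun θ => (r : ℂ) * Complex.exp ((θ : ℂ) * Complex.I)
  have hec : Continuous e := by fun_prop
  have he : ∀ θ, e θ ∈ ball (0:ℂ) 1 := fun θ => by
    rw [mem_ball_zero_iff, norm_ofReal_mul_exp r θ hr.1]; exact hr.2
  let u : ℝ → ℝ → ℝ := fun s θ => ‖f ((c s : ℂ) * e θ)‖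
  have hu : Continuous (Function.uncurry u) := by
    refine Continuous.norm (hf.continuousOn.comp_continuous (f := fun q : ℝ × ℝ =>
      (c q.1 : ℂ) * e q.2) (by fun_prop) fun q => ofReal_mul_mem_ball (hc _) (he _))
  have hup : Continuous (Function.uncurry fun s θ => u s θ ^ p) :=
    hu.rpow_const fun _ => Or.inr hp0
  have hus : Continuous (Function.uncurry fun θ s => u s θ ^ p) := hup.comp continuous_swap
  have hpoint : ∀ θ, ‖cesaro t f (e θ)‖ ^ p ≤ ((1 - t)⁻¹) ^ p * ∫ s in (0:ℝ)..1, u s θ ^ p := by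
    intro θ
    have h1 : ∫ s in (0:ℝ)..1, ‖f ((s : ℂ) * e θ)‖ = ∫ s in (0:ℝ)..1, u s θ := by
      refine intervalIntegral.integral_congr fun s hs => ?_
      rw [uIcc_of_le zero_le_one] at hs
      simp only [u, hcs s hs]
    have h2 : 0 ≤ ∫ s in (0:ℝ)..1, u s θ :=
      intervalIntegral.integral_nonneg zero_le_one fun _ _ => norm_nonneg _
    have h4 : Continuous fun s => u s θ := hu.comp (by fun_prop : Continuous fun s => (s, θ))
    calc ‖cesaro t f (e θ)‖ ^ p ≤ ((1 - t)⁻¹ * ∫ s in (0:ℝ)..1, u s θ) ^ p :=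
          Real.rpow_le_rpow (norm_nonneg _)
            ((norm_cesaro_le ht0 ht1 hf (he θ)).trans_eq (by rw [h1])) hp0
      _ = ((1 - t)⁻¹) ^ p * (∫ s in (0:ℝ)..1, u s θ) ^ p := Real.mul_rpow (by positivity) h2
      _ ≤ _ := by
        gcongr
        exact rpow_integral_le_integral_rpow hp h4 fun _ => norm_nonneg _
  have hI : Continuous fun s => ∫ θ in (0:ℝ)..(2 * Real.pi), u s θ ^ p :=
    intervalIntegral.continuous_parametric_intervalIntegral_of_continuous' hup _ _
  have hI' : Continuous fun θ => ∫ s in (0:ℝ)..1, u s θ ^ p :=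
    intervalIntegral.continuous_parametric_intervalIntegral_of_continuous' hus _ _
  have hIeq : ∀ s ∈ Icc (0:ℝ) 1,
      ∫ θ in (0:ℝ)..(2 * Real.pi), u s θ ^ p = circlePow p (s * r) f := by
    intro s hs
    simp only [u, hcs s hs, e, circlePow]
    push_cast
    simp only [mul_assoc]
  have hswap : ∫ θ in (0:ℝ)..(2 * Real.pi), ∫ s in (0:ℝ)..1, u s θ ^ p
      = ∫ s in (0:ℝ)..1, ∫ θ in (0:ℝ)..(2 * Real.pi), u s θ ^ p := by
    refine intervalIntegral_intervalIntegral_swap ?_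
    exact (hus.continuousOn.integrableOn_compact
      (isCompact_uIcc.prod isCompact_uIcc)).mono_set (prod_mono uIoc_subset_uIcc uIoc_subset_uIcc)
  have hsplit : ∫ s in (0:ℝ)..1, ∫ θ in (0:ℝ)..(2 * Real.pi), u s θ ^ p
      ≤ ρ * A + (1 - ρ) * K := by
    rw [← intervalIntegral.integral_add_adjacent_intervals (hI.intervalIntegrable 0 ρ)
      (hI.intervalIntegrable ρ 1)]
    refine add_le_add ?_ ?_
    · have := intervalIntegral.integral_mono_on (μ := volume) hρ.1 (hI.intervalIntegrable 0 ρ)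
        (intervalIntegrable_const (c := A)) fun s hs => by
          rw [hIeq s ⟨hs.1, hs.2.trans hρ.2⟩]; exact hA s hs
      simpa using this
    · have := intervalIntegral.integral_mono_on (μ := volume) hρ.2 (hI.intervalIntegrable ρ 1)
        (intervalIntegrable_const (c := K)) fun s hs => by
          have hs' : s ∈ Icc (0:ℝ) 1 := ⟨hρ.1.trans hs.1, hs.2⟩
          rw [hIeq s hs']; exact hK s hs'
      simpa using this
  calc circlePow p r (cesaro t f)
      ≤ ∫ θ in (0:ℝ)..(2 * Real.pi), ((1 - t)⁻¹) ^ p * ∫ s in (0:ℝ)..1, u s θ ^ p :=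
        intervalIntegral.integral_mono_on (by positivity)
          ((continuous_circlePow_integrand hp0
            (differentiableOn_cesaro ht0 ht1 hf).continuousOn hr).intervalIntegrable _ _)
          ((hI'.const_mul _).intervalIntegrable _ _) fun θ _ => hpoint θ
    _ ≤ _ := by
      rw [intervalIntegral.integral_const_mul, hswap]
      gcongr

lemma mul_mem_Ico {s r : ℝ} (hs : s ∈ Icc (0:ℝ) 1) (hr : r ∈ Ico (0:ℝ) 1) :
    s * r ∈ Ico (0:ℝ) 1 :=
  ⟨mul_nonneg hs.1 hr.1, (mul_le_of_le_one_left hr.1 hs.2).trans_lt hr.2⟩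

lemma MemHp.cesaro {p t : ℝ} (hp : 1 ≤ p) (ht0 : 0 < t) (ht1 : t < 1) {f : ℂ → ℂ}
    (hf : MemHp p f) : MemHp p (cesaro t f) := by
  have hp0 : 0 < p := zero_lt_one.trans_le hp
  obtain ⟨hd, C, hC⟩ := (memHp_iff hp0).1 hf
  refine (memHp_iff hp0).2 ⟨differentiableOn_cesaro ht0 ht1 hd, _, fun r hr =>
    circlePow_cesaro_le hp ht0 ht1 hd (ρ := 1) (A := C) (K := C) hr (by simp) ?_ ?_⟩ <;>
  exact fun s hs => hC _ (mul_mem_Ico hs hr)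

lemma circlePow_id_mul_le {p r : ℝ} (hp : 0 ≤ p) {f : ℂ → ℂ}
    (hf : ContinuousOn f (ball (0:ℂ) 1)) (hr : r ∈ Ico (0:ℝ) 1) :
    circlePow p r (fun z => z * f z) ≤ circlePow p r f :=
  circlePow_mono hp (continuousOn_id.mul hf) hf hr fun z hz => by
    rw [norm_mul, hz]
    exact mul_le_of_le_one_left (norm_nonneg _) hr.2.le

lemma MemHp.id_mul {p : ℝ} (hp : 0 < p) {f : ℂ → ℂ} (hf : MemHp p f) :
    MemHp p (fun z => z * f z) := by
  obtain ⟨hd, C, hC⟩ := (memHp_iff hp).1 hf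
  exact (memHp_iff hp).2 ⟨differentiableOn_id.mul hd, C, fun r hr =>
    (circlePow_id_mul_le hp.le hd.continuousOn hr).trans (hC r hr)⟩

/-- The `k`-th Taylor coefficient at the origin. -/
noncomputable def taylorCoeff (f : ℂ → ℂ) (k : ℕ) : ℂ :=
  (k.factorial : ℂ)⁻¹ * iteratedDeriv k f 0

lemma hasSum_taylorCoeff {f : ℂ → ℂ} (hf : DifferentiableOn ℂ f (ball (0:ℂ) 1)) {z : ℂ}
    (hz : z ∈ ball (0:ℂ) 1) : HasSum (fun k => taylorCoeff f k * z ^ k) (f z) := by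
  refine (Complex.hasSum_taylorSeries_on_ball hf hz).congr_fun ?_
  intro k
  simp only [taylorCoeff, smul_eq_mul, sub_zero]
  ring

lemma norm_taylorCoeff_mul_pow_le {p r : ℝ} (hp : 1 ≤ p) {f : ℂ → ℂ}
    (hf : DifferentiableOn ℂ f (ball (0:ℂ) 1)) (hr : r ∈ Ioo (0:ℝ) 1)
    (hb : circlePow p r f ≤ 2 * Real.pi) (k : ℕ) : ‖taylorCoeff f k‖ * r ^ k ≤ 2 := by
  have hp0 : 0 < p := zero_lt_one.trans_le hp
  have hpi := Real.pi_pos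
  have hr' : r ∈ Ico (0:ℝ) 1 := ⟨hr.1.le, hr.2⟩
  have hrp := hr.1
  have hcauchy := (hf.mono (closedBall_subset_ball hr.2)).circleIntegral_one_div_sub_center_pow_smul
    hr.1 k
  have h1 : (2 * Real.pi * Complex.I : ℂ) * taylorCoeff f k =
      ∮ z in C(0, r), (1 / (z - 0) ^ (k + 1)) • f z := by
    rw [hcauchy, taylorCoeff, smul_eq_mul]
    ring
  have cp := continuous_circlePow_integrand hp0.le hf.continuousOn hr'
  have h2 : ‖(2 * Real.pi * Complex.I : ℂ) * taylorCoeff f k‖ ≤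
      ∫ θ in (0:ℝ)..(2 * Real.pi),
        (r ^ k)⁻¹ * (1 + ‖f ((r : ℂ) * Complex.exp ((θ : ℂ) * Complex.I))‖ ^ p) := by
    rw [h1, circleIntegral]
    refine intervalIntegral.norm_integral_le_of_norm_le (by positivity)
      (Eventually.of_forall fun θ _ => ?_)
      (((continuous_const.add cp).const_mul _).intervalIntegrable _ _)
    have h3 : ‖circleMap 0 r θ‖ = r := by simp [abs_of_pos hrp]
    have h4 : circleMap 0 r θ = (r : ℂ) * Complex.exp ((θ : ℂ) * Complex.I) := by
      simp [circleMap]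
    have h5 : ∀ x : ℝ, 0 ≤ x → x ≤ 1 + x ^ p := fun x hx => by
      rcases le_total x 1 with h | h
      · have : 0 ≤ x ^ p := by positivity
        linarith
      · have := Real.self_le_rpow_of_one_le h hp
        linarith
    rw [deriv_circleMap, norm_smul, norm_smul, norm_mul, norm_div, norm_pow, sub_zero, h3, norm_one,
      Complex.norm_I, ← h4]
    calc r * 1 * (1 / r ^ (k + 1) * ‖f (circleMap 0 r θ)‖)
        = (r ^ k)⁻¹ * ‖f (circleMap 0 r θ)‖ := by
          field_simp
          ring
      _ ≤ _ := by gcongr; exact h5 _ (norm_nonneg _)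
  rw [intervalIntegral.integral_const_mul, intervalIntegral.integral_add
    intervalIntegrable_const (cp.intervalIntegrable _ _), norm_mul] at h2
  have h6 : ‖(2 * Real.pi * Complex.I : ℂ)‖ = 2 * Real.pi := by simp [abs_of_pos hpi]
  rw [h6] at h2
  have h7 : 2 * Real.pi * ‖taylorCoeff f k‖ ≤ (r ^ k)⁻¹ * (2 * Real.pi + 2 * Real.pi) := by
    refine h2.trans ?_
    gcongr
    · simp
    · exact hb
  rw [inv_mul_eq_div, le_div_iff₀ (by positivity)] at h7
  have h8 : 2 * Real.pi * (‖taylorCoeff f k‖ * r ^ k) ≤ 2 * Real.pi * 2 := by linarith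
  exact le_of_mul_le_mul_left h8 (by positivity)

lemma norm_taylorCoeff_le {p : ℝ} (hp : 1 ≤ p) {f : ℂ → ℂ}
    (hf : DifferentiableOn ℂ f (ball (0:ℂ) 1))
    (hb : ∀ r ∈ Ico (0:ℝ) 1, circlePow p r f ≤ 2 * Real.pi) (k : ℕ) : ‖taylorCoeff f k‖ ≤ 2 := by
  have hlim : Tendsto (fun r : ℝ => ‖taylorCoeff f k‖ * r ^ k) (𝓝[<] 1)
      (𝓝 (‖taylorCoeff f k‖ * 1 ^ k)) :=
    (Continuous.tendsto (by fun_prop) 1).mono_left nhdsWithin_le_nhds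
  rw [one_pow, mul_one] at hlim
  refine le_of_tendsto hlim ?_
  filter_upwards [Ioo_mem_nhdsLT zero_lt_one] with r hr
  exact norm_taylorCoeff_mul_pow_le hp hf hr (hb r ⟨hr.1.le, hr.2⟩) k

/-- A Montel theorem for the unit ball of the Hardy space. -/
lemma exists_subseq_tendsto_uniformly {p : ℝ} (hp : 1 ≤ p) {f : ℕ → ℂ → ℂ}
    (hf : ∀ n, DifferentiableOn ℂ (f n) (ball (0:ℂ) 1))
    (hb : ∀ n, ∀ r ∈ Ico (0:ℝ) 1, circlePow p r (f n) ≤ 2 * Real.pi) :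
    ∃ g, DifferentiableOn ℂ g (ball (0:ℂ) 1) ∧ ∃ φ : ℕ → ℕ, StrictMono φ ∧
      ∀ ρ ∈ Ico (0:ℝ) 1, ∀ δ > 0, ∀ᶠ n in atTop, ∀ z, ‖z‖ ≤ ρ → ‖f (φ n) z - g z‖ ≤ δ := by
  have hcpt : IsCompact (Set.pi univ fun _ : ℕ => closedBall (0:ℂ) 2) :=
    isCompact_univ_pi fun _ => isCompact_closedBall _ _
  obtain ⟨a, ha, φ, hφ, hlim⟩ := hcpt.tendsto_subseq (x := fun n => taylorCoeff (f n))
    fun n k _ => mem_closedBall_zero_iff.2 (norm_taylorCoeff_le hp (hf n) (hb n) k)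
  have ha2 : ∀ k, ‖a k‖ ≤ 2 := fun k => mem_closedBall_zero_iff.1 (ha k (mem_univ k))
  have hf2 : ∀ n k, ‖taylorCoeff (f n) k‖ ≤ 2 := fun n => norm_taylorCoeff_le hp (hf n) (hb n)
  have hlimk : ∀ k, Tendsto (fun n => taylorCoeff (f (φ n)) k) atTop (𝓝 (a k)) :=
    tendsto_pi_nhds.1 hlim
  let g : ℂ → ℂ := fun z => ∑' k, a k * z ^ k
  have hunif : ∀ ρ ∈ Ico (0:ℝ) 1, ∀ δ > 0, ∀ᶠ n in atTop, ∀ z, ‖z‖ ≤ ρ →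
      ‖f (φ n) z - g z‖ ≤ δ := by
    intro ρ hρ δ hδ
    have hρ0 := hρ.1
    have hgeo : Summable fun k : ℕ => 4 * ρ ^ k :=
      (summable_geometric_of_lt_one hρ.1 hρ.2).mul_left 4
    have hbd : ∀ n k, ‖taylorCoeff (f (φ n)) k - a k‖ * ρ ^ k ≤ 4 * ρ ^ k := fun n k => by
      gcongr
      linarith [norm_sub_le (taylorCoeff (f (φ n)) k) (a k), hf2 (φ n) k, ha2 k]
    have ht : Tendsto (fun n => ∑' k, ‖taylorCoeff (f (φ n)) k - a k‖ * ρ ^ k) atTop (𝓝 0) := by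
      have := tendsto_tsum_of_dominated_convergence (𝓕 := atTop)
        (f := fun n k => ‖taylorCoeff (f (φ n)) k - a k‖ * ρ ^ k) (g := fun _ => (0:ℝ)) hgeo
        (fun k => by
          have h := ((hlimk k).sub_const (a k)).norm.mul_const (ρ ^ k)
          simpa using h)
        (Eventually.of_forall fun n k => by
          rw [Real.norm_of_nonneg (by positivity)]; exact hbd n k)
      simpa using this
    filter_upwards [ht.eventually (Iio_mem_nhds hδ)] with n hn z hz
    have hz1 : z ∈ ball (0:ℂ) 1 := mem_ball_zero_iff.2 (hz.trans_lt hρ.2)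
    have hsa : Summable fun k => a k * z ^ k := by
      refine Summable.of_norm_bounded
        ((summable_geometric_of_lt_one hρ.1 hρ.2).mul_left 2) fun k => ?_
      rw [norm_mul, norm_pow]
      gcongr
      exact ha2 k
    have hs := (hasSum_taylorCoeff (hf (φ n)) hz1).sub hsa.hasSum
    have hsum : Summable fun k => ‖taylorCoeff (f (φ n)) k - a k‖ * ρ ^ k :=
      Summable.of_nonneg_of_le (fun k => by positivity) (hbd n) hgeo
    change ‖f (φ n) z - ∑' k, a k * z ^ k‖ ≤ δ
    rw [← hs.tsum_eq]
    refine (tsum_of_norm_bounded hsum.hasSum fun k => ?_).trans hn.le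
    rw [← sub_mul, norm_mul, norm_pow]
    gcongr
  refine ⟨g, ?_, φ, hφ, hunif⟩
  have hloc : TendstoLocallyUniformlyOn (fun n => f (φ n)) g atTop (ball (0:ℂ) 1) := by
    rw [Metric.tendstoLocallyUniformlyOn_iff]
    intro ε hε x hx
    rw [mem_ball_zero_iff] at hx
    obtain ⟨ρ, hxρ, hρ⟩ := exists_between hx
    refine ⟨ball 0 ρ, mem_nhdsWithin_of_mem_nhds
      (isOpen_ball.mem_nhds (mem_ball_zero_iff.2 hxρ)), ?_⟩
    filter_upwards [hunif ρ ⟨(norm_nonneg x).trans hxρ.le, hρ⟩ (ε / 2) (half_pos hε)] with n hn y hy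
    rw [dist_comm, dist_eq_norm]
    exact (hn y (mem_ball_zero_iff.1 hy).le).trans_lt (half_lt_self hε)
  exact hloc.differentiableOn (Eventually.of_forall fun n => hf (φ n)) isOpen_ball

lemma exists_subseq_circlePow_cesaro_sub_le {p t : ℝ} (hp : 1 ≤ p) (ht0 : 0 < t) (ht1 : t < 1)
    {f : ℕ → ℂ → ℂ} (hf : ∀ n, MemHp p (f n) ∧ hardyNorm p (f n) ≤ 1) :
    ∃ g, MemHp p g ∧ ∃ φ : ℕ → ℕ, StrictMono φ ∧ ∀ ε > 0, ∀ᶠ n in atTop, ∀ r ∈ Ico (0:ℝ) 1,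
      circlePow p r (fun z => cesaro t (f (φ n)) z - cesaro t g z) ≤ ε := by
  have hp0 : 0 < p := zero_lt_one.trans_le hp
  have hpi := Real.pi_pos
  have hd : ∀ n, DifferentiableOn ℂ (f n) (ball (0:ℂ) 1) := fun n => (hf n).1.1
  have hb : ∀ n, ∀ r ∈ Ico (0:ℝ) 1, circlePow p r (f n) ≤ 2 * Real.pi := fun n r hr =>
    circlePow_le_of_hardyNorm_le_one hp0 (hf n).1 (hf n).2 hr
  obtain ⟨g, hg, φ, hφ, hunif⟩ := exists_subseq_tendsto_uniformly hp hd hb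
  have hgb : ∀ r ∈ Ico (0:ℝ) 1, circlePow p r g ≤ 2 ^ p * (2 * Real.pi + 2 * Real.pi) := by
    intro r hr
    obtain ⟨n, hn⟩ := (hunif r hr 1 one_pos).exists
    refine (circlePow_le_of_norm_le_add hp0.le hg.continuousOn (hd (φ n)).continuousOn
      (continuousOn_const (c := (1:ℂ))) hr fun z hz => ?_).trans ?_
    · rw [norm_one]
      linarith [norm_le_norm_add_norm_sub (f (φ n) z) (g z), hn z hz.le]
    · gcongr
      · exact hb _ r hr
      · simp [circlePow_const]
  set B := 2 ^ p * (2 * Real.pi + 2 * Real.pi) with hB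
  set K := 2 ^ p * (2 * Real.pi + B) with hK
  have hK0 : 0 < K := by positivity
  refine ⟨g, (memHp_iff hp0).2 ⟨hg, B, hgb⟩, φ, hφ, fun ε hε => ?_⟩
  set M := ((1 - t)⁻¹) ^ p with hM
  have hM0 : 0 < M := Real.rpow_pos_of_pos (inv_pos.2 (sub_pos.2 ht1)) p
  obtain ⟨ρ, hρ0, hρ1, hρ⟩ : ∃ ρ : ℝ, 0 ≤ ρ ∧ ρ < 1 ∧ M * ((1 - ρ) * K) ≤ ε / 2 := by
    refine ⟨max 0 (1 - ε / (2 * M * K)), le_max_left _ _, max_lt one_pos ?_, ?_⟩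
    · have : 0 < ε / (2 * M * K) := by positivity
      linarith
    · calc M * ((1 - max 0 (1 - ε / (2 * M * K))) * K) ≤ M * (ε / (2 * M * K) * K) := by
            gcongr
            linarith [le_max_right 0 (1 - ε / (2 * M * K))]
        _ = ε / 2 := by field_simp
  let δ : ℝ := (ε / (4 * Real.pi * M)) ^ p⁻¹
  have hδ : 0 < δ := by positivity
  have hδp : M * (2 * Real.pi * δ ^ p) = ε / 2 := by
    rw [Real.rpow_inv_rpow (by positivity) hp0.ne']
    field_simp
    ring
  filter_upwards [hunif ρ ⟨hρ0, hρ1⟩ δ hδ] with n hn r hr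
  have hhd : DifferentiableOn ℂ (fun w => f (φ n) w - g w) (ball (0:ℂ) 1) := (hd (φ n)).sub hg
  have h1 : circlePow p r (fun z => cesaro t (f (φ n)) z - cesaro t g z)
      ≤ circlePow p r (cesaro t fun w => f (φ n) w - g w) := by
    refine circlePow_mono hp0.le ((differentiableOn_cesaro ht0 ht1 (hd _)).sub
      (differentiableOn_cesaro ht0 ht1 hg)).continuousOn
      (differentiableOn_cesaro ht0 ht1 hhd).continuousOn hr fun z hz => ?_
    rw [cesaro_sub ht0 ht1 (hd _) hg (mem_ball_zero_iff.2 (hz.trans_lt hr.2))]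
  have h2 := circlePow_cesaro_le hp ht0 ht1 hhd (ρ := ρ) (A := 2 * Real.pi * δ ^ p) (K := K) hr
    ⟨hρ0, hρ1.le⟩ (fun s hs => ?_) (fun s hs => ?_)
  · refine h1.trans (h2.trans ?_)
    rw [mul_add]
    have h3 : M * (ρ * (2 * Real.pi * δ ^ p)) ≤ M * (2 * Real.pi * δ ^ p) := by
      exact mul_le_mul_of_nonneg_left (mul_le_of_le_one_left (by positivity) hρ1.le) hM0.le
    linarith
  · have hs' : s ∈ Icc (0:ℝ) 1 := ⟨hs.1, hs.2.trans hρ1.le⟩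
    refine (circlePow_mono (f := fun _ => (δ : ℂ)) hp0.le hhd.continuousOn continuousOn_const
      (mul_mem_Ico hs' hr) fun z hz => ?_).trans_eq ?_
    · rw [Complex.norm_real, Real.norm_of_nonneg hδ.le]
      refine hn z (hz.trans_le ?_)
      exact (mul_le_of_le_one_right hs.1 hr.2.le).trans hs.2
    · rw [circlePow_const, Complex.norm_real, Real.norm_of_nonneg hδ.le]
  · refine (circlePow_le_of_norm_le_add hp0.le hhd.continuousOn (hd _).continuousOn
      hg.continuousOn (mul_mem_Ico hs hr) fun z _ => norm_sub_le _ _).trans ?_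
    have h4 := hb (φ n) _ (mul_mem_Ico hs hr)
    have h5 := hgb _ (mul_mem_Ico hs hr)
    rw [hK]
    gcongr

lemma tendsto_hardyNorm_zero {p : ℝ} (hp : 0 < p) {u : ℕ → ℂ → ℂ}
    (h : ∀ ε > 0, ∀ᶠ n in atTop, ∀ r ∈ Ico (0:ℝ) 1, circlePow p r (u n) ≤ ε) :
    Tendsto (fun n => hardyNorm p (u n)) atTop (𝓝 0) := by
  have hpi := Real.pi_pos
  rw [Metric.tendsto_nhds]
  intro ε hε
  filter_upwards [h (2 * Real.pi * (ε / 2) ^ p) (by positivity)] with n hn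
  rw [Real.dist_0_eq_abs, abs_of_nonneg (hardyNorm_nonneg _ _)]
  exact (hardyNorm_le hp (by positivity) hn).trans_lt (half_lt_self hε)

/-- For `1 ≤ p < ∞` and `t ∈ (0,1)`, the generalized Cesàro operator `C_t : H^p → H^p`
is compact, and consequently also the operator `S_t = S ∘ C_t`,
`(S_t f)(z) = ∫_0^z f(ξ)/(1-tξ) dξ = z (C_t f)(z)`, is compact on `H^p`
(sequential formulation of the relative compactness of the image of the unit ball). -/
theorem cesaro_compact_Hp (p t : ℝ) (hp : 1 ≤ p) (ht0 : 0 < t) (ht1 : t < 1) :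
    ((∀ f, MemHp p f → MemHp p (cesaro t f)) ∧
      (∀ f : ℕ → ℂ → ℂ, (∀ n, MemHp p (f n) ∧ hardyNorm p (f n) ≤ 1) →
        ∃ g, MemHp p g ∧ ∃ φ : ℕ → ℕ, StrictMono φ ∧
          Tendsto (fun n => hardyNorm p (fun z => cesaro t (f (φ n)) z - g z))
            atTop (𝓝 0))) ∧
    ((∀ f, MemHp p f → MemHp p (fun z => z * cesaro t f z)) ∧
      (∀ f : ℕ → ℂ → ℂ, (∀ n, MemHp p (f n) ∧ hardyNorm p (f n) ≤ 1) →
        ∃ g, MemHp p g ∧ ∃ φ : ℕ → ℕ, StrictMono φ ∧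
          Tendsto (fun n => hardyNorm p (fun z => z * cesaro t (f (φ n)) z - g z))
            atTop (𝓝 0))) := by
  have hp0 : 0 < p := zero_lt_one.trans_le hp
  refine ⟨⟨fun f hf => hf.cesaro hp ht0 ht1, fun f hf => ?_⟩,
    fun f hf => (hf.cesaro hp ht0 ht1).id_mul hp0, fun f hf => ?_⟩
  · obtain ⟨g, hg, φ, hφ, h⟩ := exists_subseq_circlePow_cesaro_sub_le hp ht0 ht1 hf
    exact ⟨cesaro t g, hg.cesaro hp ht0 ht1, φ, hφ, tendsto_hardyNorm_zero hp0 h⟩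
  · obtain ⟨g, hg, φ, hφ, h⟩ := exists_subseq_circlePow_cesaro_sub_le hp ht0 ht1 hf
    refine ⟨fun z => z * cesaro t g z, (hg.cesaro hp ht0 ht1).id_mul hp0, φ, hφ,
      tendsto_hardyNorm_zero hp0 fun ε hε => ?_⟩
    filter_upwards [h ε hε] with n hn r hr
    simp only [← mul_sub]
    exact (circlePow_id_mul_le hp0.le (((hf _).1.cesaro hp ht0 ht1).1.sub
      (hg.cesaro hp ht0 ht1).1).continuousOn hr).trans (hn r hr)
end
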